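/- Let g be a unitary operator on a finite-dimensional complex inner product space V and h a unitary operator on a finite-dimensional complex inner product space W. Then age*(g ⊕ h) ≥ age*(g) + age*(h) for the block-diagonal operator g ⊕ h on V ⊕ W, and age*(g ⊗ h) ≥ dim(W) · age*(g) for the tensor product operator g ⊗ h on V ⊗ W. -/

import Mathlib

open scoped Real

/-- The age of a unitary matrix: if its eigenvalues, with multiplicity (the roots of
its characteristic polynomial), are `e^{2πi r_1}, …, e^{2πi r_n}` with `0 ≤ r_j < 1`,
then `age(g) = Σ_j r_j`. -/
noncomputable def matAge {ι : Type*} [Fintype ι] [DecidableEq ι]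
    (g : Matrix ι ι ℂ) : ℝ :=
  (g.charpoly.roots.map (fun z => Int.fract (z.arg / (2 * π)))).sum

/-- The reduced age `age*(g) = inf_{λ ∈ S¹} age(λ g)`. -/
noncomputable def matAgeStar {ι : Type*} [Fintype ι] [DecidableEq ι]
    (g : Matrix ι ι ℂ) : ℝ :=
  ⨅ c : Metric.sphere (0 : ℂ) 1, matAge ((c : ℂ) • g)

open Polynomial in
/-- The determinant of `q(h)` is the product of the values of `q` at the eigenvalues of `h`. -/
lemma Matrix.det_aeval_eq_prod_roots {K κ : Type*} [Field K] [IsAlgClosed K] [Fintype κ]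
    [DecidableEq κ] (h : Matrix κ κ K) (q : K[X]) :
    (aeval h q).det = (h.charpoly.roots.map fun d => q.eval d).prod := by
  have hcard : Multiset.card h.charpoly.roots = Fintype.card κ := by
    rw [← (IsAlgClosed.splits h.charpoly).natDegree_eq_card_roots,
      Matrix.charpoly_natDegree_eq_dim]
  have hmul : ∀ p q : K[X],
      (aeval h p).det = (h.charpoly.roots.map fun d => p.eval d).prod →
      (aeval h q).det = (h.charpoly.roots.map fun d => q.eval d).prod →
      (aeval h (p * q)).det = (h.charpoly.roots.map fun d => (p * q).eval d).prod := by
    intro p q hp hq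
    simp [hp, hq, Multiset.prod_map_mul]
  have hC : ∀ a : K,
      (aeval h (C a)).det = (h.charpoly.roots.map fun d => (C a).eval d).prod := by
    intro a
    simp [hcard, Matrix.algebraMap_eq_diagonal]
  have hlin : ∀ a : K,
      (aeval h (C a - X)).det = (h.charpoly.roots.map fun d => (C a - X).eval d).prod := by
    intro a
    have h1 : (aeval h (C a - X)).det = h.charpoly.eval a := by
      rw [Matrix.eval_charpoly]
      simp [Matrix.algebraMap_eq_diagonal, Matrix.scalar_apply, Pi.algebraMap_def]
    rw [h1, (IsAlgClosed.splits h.charpoly).eval_eq_prod_roots]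
    simp [(Matrix.charpoly_monic h).leadingCoeff]
  rw [(IsAlgClosed.splits q).eq_prod_roots]
  refine hmul _ _ (hC _) ?_
  induction q.roots using Multiset.induction_on with
  | empty => simp
  | cons a s ih =>
    rw [Multiset.map_cons, Multiset.prod_cons]
    refine hmul _ _ ?_ ih
    have : (X - C a : K[X]) = C (-1) * (C a - X) := by simp
    rw [this]
    exact hmul _ _ (hC _) (hlin _)

open Polynomial in
/-- The characteristic polynomial of `g ⊗ h` is the product of those of `d • g`, for `d` running
through the eigenvalues of `h`. -/
lemma Matrix.charpoly_kronecker_eq_prod_roots {K ι κ : Type*} [Field K] [IsAlgClosed K]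
    [Fintype ι] [DecidableEq ι] [Fintype κ] [DecidableEq κ]
    (g : Matrix ι ι K) (h : Matrix κ κ K) :
    (Matrix.kroneckerMap (· * ·) g h).charpoly =
      (h.charpoly.roots.map fun d => (d • g).charpoly).prod := by
  refine Polynomial.funext fun x => ?_
  let N : Matrix ι ι K[X] := Matrix.scalar ι (C x) - g.map fun a => C a * X
  have key := Matrix.det_det (m := ι) (n := κ) (R := K) N (aeval h).toRingHom
  have h1 : (N.map (aeval h).toRingHom).comp ι ι κ κ K =
      Matrix.scalar (ι × κ) x - Matrix.kroneckerMap (· * ·) g h := by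
    ext ⟨i, k⟩ ⟨j, l⟩
    change aeval h (N i j) k l = _
    by_cases hij : i = j <;> by_cases hkl : k = l <;>
      simp [N, hij, hkl, Matrix.algebraMap_matrix_apply, ← Algebra.smul_def]
  have h2 : ∀ d : K, N.det.eval d = (d • g).charpoly.eval x := by
    intro d
    rw [Matrix.eval_charpoly, ← Polynomial.coe_evalRingHom, RingHom.map_det]
    congr 1
    ext i j
    by_cases hij : i = j <;> simp [N, hij, mul_comm d]
  rw [h1] at key
  rw [Matrix.eval_charpoly, ← key, Polynomial.eval_multiset_prod, Multiset.map_map]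
  simpa [Function.comp_def, h2] using Matrix.det_aeval_eq_prod_roots h N.det

lemma Matrix.norm_eq_one_of_mem_roots_charpoly {κ : Type*} [Fintype κ] [DecidableEq κ]
    {h : Matrix κ κ ℂ} (hh : h ∈ Matrix.unitaryGroup κ ℂ) {d : ℂ} (hd : d ∈ h.charpoly.roots) :
    ‖d‖ = 1 := by
  open scoped Matrix.Norms.L2Operator in
  exact spectrum.norm_eq_one_of_unitary (𝕜 := ℂ) (E := Matrix κ κ ℂ) hh
    (Matrix.mem_spectrum_of_isRoot_charpoly (Polynomial.isRoot_of_mem_roots hd))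

lemma matAge_nonneg {ι : Type*} [Fintype ι] [DecidableEq ι] (g : Matrix ι ι ℂ) :
    0 ≤ matAge g := by
  refine Multiset.sum_nonneg fun x hx => ?_
  obtain ⟨z, -, rfl⟩ := Multiset.mem_map.mp hx
  exact Int.fract_nonneg _

lemma matAgeStar_le {ι : Type*} [Fintype ι] [DecidableEq ι] (g : Matrix ι ι ℂ) {c : ℂ}
    (hc : ‖c‖ = 1) : matAgeStar g ≤ matAge (c • g) :=
  ciInf_le (f := fun c : Metric.sphere (0 : ℂ) 1 => matAge ((c : ℂ) • g))
    ⟨0, by rintro _ ⟨c, rfl⟩; exact matAge_nonneg _⟩ ⟨c, by simpa using hc⟩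

lemma matAge_fromBlocks {ι κ : Type*} [Fintype ι] [DecidableEq ι] [Fintype κ] [DecidableEq κ]
    (g : Matrix ι ι ℂ) (h : Matrix κ κ ℂ) :
    matAge (Matrix.fromBlocks g 0 0 h) = matAge g + matAge h := by
  rw [matAge, Matrix.charpoly_fromBlocks_zero₁₂, Polynomial.roots_mul, Multiset.map_add,
    Multiset.sum_add, matAge, matAge]
  exact mul_ne_zero (Matrix.charpoly_monic g).ne_zero (Matrix.charpoly_monic h).ne_zero

lemma matAge_kronecker {ι κ : Type*} [Fintype ι] [DecidableEq ι] [Fintype κ] [DecidableEq κ]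
    (g : Matrix ι ι ℂ) (h : Matrix κ κ ℂ) :
    matAge (Matrix.kroneckerMap (· * ·) g h) =
      (h.charpoly.roots.map fun d => matAge (d • g)).sum := by
  rw [matAge, Matrix.charpoly_kronecker_eq_prod_roots, Polynomial.roots_multiset_prod,
    Multiset.bind_map, Multiset.map_bind, Multiset.sum_bind]
  · rfl
  · intro h0
    obtain ⟨d, -, hd⟩ := Multiset.mem_map.mp h0
    exact (Matrix.charpoly_monic _).ne_zero hd

/-- Let `g` be a unitary operator on an `n`-dimensional complex inner
product space `V` and `h` a unitary operator on a `p`-dimensional complex inner product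
space `W`. Then `age*(g ⊕ h) ≥ age*(g) + age*(h)` for the block-diagonal operator
`g ⊕ h` on `V ⊕ W`, and `age*(g ⊗ h) ≥ dim(W) · age*(g)` for the tensor (Kronecker)
product operator `g ⊗ h` on `V ⊗ W`. -/
theorem stmt12 (n p : ℕ) (g : Matrix (Fin n) (Fin n) ℂ) (h : Matrix (Fin p) (Fin p) ℂ)
    (hg : g ∈ Matrix.unitaryGroup (Fin n) ℂ)
    (hh : h ∈ Matrix.unitaryGroup (Fin p) ℂ) :
    matAgeStar g + matAgeStar h ≤ matAgeStar (Matrix.fromBlocks g 0 0 h) ∧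
      (p : ℝ) * matAgeStar g ≤ matAgeStar (Matrix.kroneckerMap (· * ·) g h) := by
  have : Nonempty (Metric.sphere (0 : ℂ) 1) := ⟨⟨1, by simp⟩⟩
  refine ⟨le_ciInf fun c => ?_, le_ciInf fun c => ?_⟩
  · have hc : ‖(c : ℂ)‖ = 1 := by simp
    rw [Matrix.fromBlocks_smul, smul_zero, smul_zero, matAge_fromBlocks]
    exact add_le_add (matAgeStar_le g hc) (matAgeStar_le h hc)
  · have hc : ‖(c : ℂ)‖ = 1 := by simp
    have hsmul : (c : ℂ) • Matrix.kroneckerMap (· * ·) g h =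
        Matrix.kroneckerMap (· * ·) ((c : ℂ) • g) h := by
      ext
      simp [mul_assoc]
    have hcard : Multiset.card h.charpoly.roots = p := by
      rw [← (IsAlgClosed.splits h.charpoly).natDegree_eq_card_roots,
        Matrix.charpoly_natDegree_eq_dim, Fintype.card_fin]
    rw [hsmul, matAge_kronecker]
    calc (p : ℝ) * matAgeStar g
        = Multiset.card (h.charpoly.roots.map fun d => matAge (d • (c : ℂ) • g)) •
            matAgeStar g := by
          rw [Multiset.card_map, hcard, nsmul_eq_mul]
      _ ≤ _ := Multiset.card_nsmul_le_sum fun x hx => by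
          obtain ⟨d, hd, rfl⟩ := Multiset.mem_map.mp hx
          rw [smul_smul]
          exact matAgeStar_le g
            (by rw [norm_mul, hc, Matrix.norm_eq_one_of_mem_roots_charpoly hh hd, one_mul])
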